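/- arXiv:2102.01371 — 2 statements merged into one kernel-verified Lean document; each statement's English description precedes it below -/
import Mathlib

section
/- Let m ≥ 1 be an integer, and for each i ∈ {1,…,m} let α_i ∈ (1,2), l_i > 0, and n_i ≥ 1. Define q(θ) = Σ_{i=1}^m l_i·|θ_i|^{α_i} and g(θ) = Σ_{i=1}^m l_i·g_{α_i}(θ_i) on [−π,π]^m, and set c_2 = max_{1≤i≤m} π²/(−8·cos(πα_i/2)). Let Q and G be the multilevel Toeplitz matrices (with sizes n_1,…,n_m) generated by q and by g, respectively. Then for every real vector z one has (1/2)·zᵀGz ≤ zᵀQz ≤ c_2·zᵀGz; in particular, every eigenvalue of G^{−1}Q lies in [1/2, c_2]. -/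
open Real Matrix

/-- The generating function `g_α(θ) = -2^{α+1} (sin(|θ|/2))^α cos(α(π-|θ|)/2 + |θ|)`. -/
noncomputable def gFun (α θ : ℝ) : ℝ :=
  -(2 : ℝ) ^ (α + 1) * Real.sin (|θ| / 2) ^ α * Real.cos (α * (π - |θ|) / 2 + |θ|)

open MeasureTheory

/-- The multilevel Toeplitz matrix generated by an integrable `f` on `[-π,π]^m`:
the `(x,y)` entry is `(2π)^{-m} ∫_{[-π,π]^m} f(θ) cos(Σ_i θ_i (x_i - y_i)) dθ`. -/
noncomputable def mToeplitz {m : ℕ} (n : Fin m → ℕ) (f : (Fin m → ℝ) → ℝ) :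
    Matrix ((i : Fin m) → Fin (n i)) ((i : Fin m) → Fin (n i)) ℝ :=
  fun x y => (2 * Real.pi) ^ (-(m : ℤ)) *
    ∫ θ in Set.univ.pi fun _ : Fin m => Set.Icc (-Real.pi) Real.pi,
      f θ * Real.cos (∑ i, θ i * (((x i : ℕ) : ℝ) - ((y i : ℕ) : ℝ)))

theorem neg_cos_pi_mul_half_pos {α : ℝ} (hα : α ∈ Set.Ioo (1 : ℝ) 2) :
    0 < -Real.cos (π * α / 2) := by
  have hπ := Real.pi_pos
  have := Real.cos_neg_of_pi_div_two_lt_of_lt (x := π * α / 2)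
    (by nlinarith [hα.1]) (by nlinarith [hα.2])
  linarith

theorem neg_cos_pi_mul_half_le {α t : ℝ} (hα : α ∈ Set.Ioo (1 : ℝ) 2)
    (ht₀ : 0 ≤ t) (ht : t ≤ π) :
    -Real.cos (π * α / 2) ≤ -Real.cos (α * (π - t) / 2 + t) := by
  have hπ := Real.pi_pos
  refine neg_le_neg (Real.cos_le_cos_of_nonneg_of_le_pi ?_ ?_ ?_)
  · nlinarith [hα.1]
  · nlinarith [hα.2]
  · nlinarith [hα.2]

theorem gFun_eq {α θ : ℝ} (hθ : |θ| ≤ π) :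
    gFun α θ = 2 * (2 * Real.sin (|θ| / 2)) ^ α * -Real.cos (α * (π - |θ|) / 2 + |θ|) := by
  have hs : 0 ≤ Real.sin (|θ| / 2) :=
    Real.sin_nonneg_of_nonneg_of_le_pi (by positivity) (by linarith [abs_nonneg θ])
  rw [gFun, Real.mul_rpow two_pos.le hs, Real.rpow_add_one two_ne_zero]
  ring

theorem gFun_nonneg {α θ : ℝ} (hα : α ∈ Set.Ioo (1 : ℝ) 2) (hθ : |θ| ≤ π) :
    0 ≤ gFun α θ := by
  have hs : 0 ≤ Real.sin (|θ| / 2) :=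
    Real.sin_nonneg_of_nonneg_of_le_pi (by positivity) (by linarith [abs_nonneg θ])
  rw [gFun_eq hθ]
  have := (neg_cos_pi_mul_half_pos hα).le.trans (neg_cos_pi_mul_half_le hα (abs_nonneg θ) hθ)
  positivity

theorem gFun_le {α θ : ℝ} (hα : α ∈ Set.Ioo (1 : ℝ) 2) (hθ : |θ| ≤ π) :
    (1 / 2) * gFun α θ ≤ |θ| ^ α := by
  have hs : 0 ≤ Real.sin (|θ| / 2) :=
    Real.sin_nonneg_of_nonneg_of_le_pi (by positivity) (by linarith [abs_nonneg θ])
  have hsin : 2 * Real.sin (|θ| / 2) ≤ |θ| := by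
    linarith [Real.sin_le (x := |θ| / 2) (by positivity)]
  have hpow : (2 * Real.sin (|θ| / 2)) ^ α ≤ |θ| ^ α :=
    Real.rpow_le_rpow (by positivity) hsin (by linarith [hα.1])
  have hnn : 0 ≤ (2 * Real.sin (|θ| / 2)) ^ α := by positivity
  rw [gFun_eq hθ]
  nlinarith [Real.neg_one_le_cos (α * (π - |θ|) / 2 + |θ|)]

theorem abs_rpow_le_gFun {α θ : ℝ} (hα : α ∈ Set.Ioo (1 : ℝ) 2) (hθ : |θ| ≤ π) :
    |θ| ^ α ≤ π ^ 2 / (-8 * Real.cos (π * α / 2)) * gFun α θ := by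
  have hα₀ : 0 ≤ α := by linarith [hα.1]
  have hs : 0 ≤ Real.sin (|θ| / 2) :=
    Real.sin_nonneg_of_nonneg_of_le_pi (by positivity) (by linarith [abs_nonneg θ])
  have hπ := Real.pi_pos
  have hsin : |θ| ≤ π / 2 * (2 * Real.sin (|θ| / 2)) := by
    have := Real.mul_le_sin (x := |θ| / 2) (by positivity) (by linarith)
    calc |θ| = π * (2 / π * (|θ| / 2)) := by field_simp
      _ ≤ π * Real.sin (|θ| / 2) := by gcongr
      _ = _ := by ring
  have hpow : |θ| ^ α ≤ π ^ 2 / 4 * (2 * Real.sin (|θ| / 2)) ^ α := by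
    calc |θ| ^ α ≤ (π / 2 * (2 * Real.sin (|θ| / 2))) ^ α :=
          Real.rpow_le_rpow (abs_nonneg θ) hsin hα₀
      _ = (π / 2) ^ α * (2 * Real.sin (|θ| / 2)) ^ α :=
          Real.mul_rpow (by positivity) (by positivity)
      _ ≤ (π / 2) ^ (2 : ℝ) * (2 * Real.sin (|θ| / 2)) ^ α := by
          gcongr
          · linarith [Real.two_le_pi]
          · exact hα.2.le
      _ = _ := by rw [Real.rpow_two]; ring
  have hc := neg_cos_pi_mul_half_pos hα
  have hle := neg_cos_pi_mul_half_le hα (abs_nonneg θ) hθ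
  rw [gFun_eq hθ, div_mul_eq_mul_div, le_div_iff₀ (by linarith)]
  calc |θ| ^ α * (-8 * Real.cos (π * α / 2))
      = 8 * (|θ| ^ α * -Real.cos (π * α / 2)) := by ring
    _ ≤ 8 * ((π ^ 2 / 4 * (2 * Real.sin (|θ| / 2)) ^ α) *
          -Real.cos (α * (π - |θ|) / 2 + |θ|)) := by gcongr
    _ = _ := by ring

theorem continuous_gFun {α : ℝ} (hα : 0 ≤ α) : Continuous (gFun α) := by
  unfold gFun
  have : Continuous fun θ : ℝ => Real.sin (|θ| / 2) ^ α :=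
    Continuous.rpow_const (by fun_prop) fun _ => Or.inr hα
  fun_prop

/-- The squared modulus `|∑ x, z x * exp (i θ·x)|²`, expanded as a double sum. -/
theorem sum_mul_cos_sub_nonneg {ι : Type*} [Fintype ι] (z a : ι → ℝ) :
    0 ≤ ∑ x, ∑ y, z x * z y * Real.cos (a x - a y) := by
  have h : ∑ x, ∑ y, z x * z y * Real.cos (a x - a y) =
      (∑ x, z x * Real.cos (a x)) ^ 2 + (∑ x, z x * Real.sin (a x)) ^ 2 := by
    simp only [sq, Finset.sum_mul_sum, ← Finset.sum_add_distrib, Real.cos_sub]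
    refine Finset.sum_congr rfl fun x _ => Finset.sum_congr rfl fun y _ => ?_
    ring
  rw [h]
  positivity

theorem isCompact_cube (m : ℕ) :
    IsCompact (Set.univ.pi fun _ : Fin m => Set.Icc (-Real.pi) Real.pi) :=
  isCompact_univ_pi fun _ => isCompact_Icc

theorem dotProduct_mToeplitz_mulVec {m : ℕ} (n : Fin m → ℕ) {f : (Fin m → ℝ) → ℝ}
    (hf : Continuous f) (z : ((i : Fin m) → Fin (n i)) → ℝ) :
    z ⬝ᵥ (mToeplitz n f).mulVec z = (2 * Real.pi) ^ (-(m : ℤ)) *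
      ∫ θ in Set.univ.pi fun _ : Fin m => Set.Icc (-Real.pi) Real.pi,
        f θ * ∑ x, ∑ y, z x * z y *
          Real.cos (∑ i, θ i * ((x i : ℕ) : ℝ) - ∑ i, θ i * ((y i : ℕ) : ℝ)) := by
  have hint : ∀ x y : (i : Fin m) → Fin (n i), IntegrableOn
      (fun θ : Fin m → ℝ => z x * z y * (f θ *
        Real.cos (∑ i, θ i * (((x i : ℕ) : ℝ) - ((y i : ℕ) : ℝ)))))
      (Set.univ.pi fun _ : Fin m => Set.Icc (-Real.pi) Real.pi) := fun x y =>
    ContinuousOn.integrableOn_compact (isCompact_cube m) (by fun_prop)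
  have hrw : ∀ θ : Fin m → ℝ, (f θ * ∑ x, ∑ y, z x * z y *
        Real.cos (∑ i, θ i * ((x i : ℕ) : ℝ) - ∑ i, θ i * ((y i : ℕ) : ℝ))) =
      ∑ x : (i : Fin m) → Fin (n i), ∑ y : (i : Fin m) → Fin (n i), z x * z y * (f θ *
        Real.cos (∑ i, θ i * (((x i : ℕ) : ℝ) - ((y i : ℕ) : ℝ)))) := by
    intro θ
    simp only [Finset.mul_sum, mul_sub, Finset.sum_sub_distrib]
    refine Finset.sum_congr rfl fun x _ => Finset.sum_congr rfl fun y _ => ?_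
    ring
  simp only [hrw]
  rw [integral_finsetSum _ fun x _ => integrable_finsetSum _ fun y _ => hint x y]
  simp only [dotProduct, mulVec, Finset.mul_sum]
  refine Finset.sum_congr rfl fun x _ => ?_
  rw [integral_finsetSum _ fun y _ => hint x y, Finset.mul_sum]
  refine Finset.sum_congr rfl fun y _ => ?_
  rw [integral_const_mul, mToeplitz]
  ring

/-- The quadratic form of a multilevel Toeplitz matrix is monotone in the generating function. -/
theorem mul_dotProduct_mToeplitz_mono {m : ℕ} (n : Fin m → ℕ) {f g : (Fin m → ℝ) → ℝ}
    (hf : Continuous f) (hg : Continuous g) (a b : ℝ)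
    (hfg : ∀ θ : Fin m → ℝ, (∀ i, |θ i| ≤ π) → a * f θ ≤ b * g θ)
    (z : ((i : Fin m) → Fin (n i)) → ℝ) :
    a * (z ⬝ᵥ (mToeplitz n f).mulVec z) ≤ b * (z ⬝ᵥ (mToeplitz n g).mulVec z) := by
  rw [dotProduct_mToeplitz_mulVec n hf, dotProduct_mToeplitz_mulVec n hg, mul_left_comm a,
    mul_left_comm b, ← integral_const_mul a, ← integral_const_mul b]
  refine mul_le_mul_of_nonneg_left ?_ (zpow_nonneg Real.two_pi_pos.le _)
  refine setIntegral_mono_on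
    (ContinuousOn.integrableOn_compact (isCompact_cube m) (by fun_prop))
    (ContinuousOn.integrableOn_compact (isCompact_cube m) (by fun_prop))
    (isCompact_cube m).measurableSet fun θ hθ => ?_
  rw [← mul_assoc, ← mul_assoc]
  exact mul_le_mul_of_nonneg_right
    (hfg θ fun i => abs_le.2 (hθ i (Set.mem_univ i))) (sum_mul_cos_sub_nonneg z _)

theorem rayleigh_Q_G (m : ℕ) (hm : 1 ≤ m) (n : Fin m → ℕ) (hn : ∀ i, 1 ≤ n i)
    (α l : Fin m → ℝ) (hα : ∀ i, α i ∈ Set.Ioo (1 : ℝ) 2) (hl : ∀ i, 0 < l i)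
    (z : ((i : Fin m) → Fin (n i)) → ℝ) :
    (1 / 2) * (z ⬝ᵥ (mToeplitz n (fun θ => ∑ i, l i * gFun (α i) (θ i))).mulVec z) ≤
      z ⬝ᵥ (mToeplitz n (fun θ => ∑ i, l i * |θ i| ^ (α i))).mulVec z ∧
    z ⬝ᵥ (mToeplitz n (fun θ => ∑ i, l i * |θ i| ^ (α i))).mulVec z ≤
      (Finset.univ.sup' ⟨(⟨0, hm⟩ : Fin m), Finset.mem_univ _⟩
          (fun i => π ^ 2 / (-8 * Real.cos (π * α i / 2)))) *
        (z ⬝ᵥ (mToeplitz n (fun θ => ∑ i, l i * gFun (α i) (θ i))).mulVec z) := by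
  have hα₀ : ∀ i, 0 ≤ α i := fun i => by linarith [(hα i).1]
  have hcq : Continuous fun θ : Fin m → ℝ => ∑ i, l i * |θ i| ^ (α i) := by
    refine continuous_finsetSum _ fun i _ => continuous_const.mul ?_
    exact Continuous.rpow_const (by fun_prop) fun _ => Or.inr (hα₀ i)
  have hcg : Continuous fun θ : Fin m → ℝ => ∑ i, l i * gFun (α i) (θ i) :=
    continuous_finsetSum _ fun i _ =>
      continuous_const.mul ((continuous_gFun (hα₀ i)).comp (continuous_apply i))
  constructor
  · rw [← one_mul (z ⬝ᵥ (mToeplitz n (fun θ => ∑ i, l i * |θ i| ^ (α i))).mulVec z)]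
    refine mul_dotProduct_mToeplitz_mono n hcg hcq _ _ (fun θ hθ => ?_) z
    rw [one_mul, Finset.mul_sum]
    refine Finset.sum_le_sum fun i _ => ?_
    rw [mul_left_comm]
    exact mul_le_mul_of_nonneg_left (gFun_le (hα i) (hθ i)) (hl i).le
  · rw [← one_mul (z ⬝ᵥ (mToeplitz n (fun θ => ∑ i, l i * |θ i| ^ (α i))).mulVec z)]
    refine mul_dotProduct_mToeplitz_mono n hcq hcg _ _ (fun θ hθ => ?_) z
    rw [one_mul, Finset.mul_sum]
    refine Finset.sum_le_sum fun i _ => ?_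
    rw [mul_left_comm]
    refine mul_le_mul_of_nonneg_left ((abs_rpow_le_gFun (hα i) (hθ i)).trans ?_) (hl i).le
    exact mul_le_mul_of_nonneg_right
      (Finset.le_sup' (fun i => π ^ 2 / (-8 * Real.cos (π * α i / 2))) (Finset.mem_univ i))
      (gFun_nonneg (hα i) (hθ i))
end

section
/- Let m ≥ 1 be an integer, and for each i ∈ {1,…,m} let α_i ∈ (1,2), l_i > 0, and n_i ≥ 1. Define q(θ) = Σ_{i=1}^m l_i·|θ_i|^{α_i} on [−π,π]^m and set c_2 = max_{1≤i≤m} π²/(−8·cos(πα_i/2)). Let p : [−π,π]^m → ℝ be integrable with c_0·q(θ) ≤ p(θ) ≤ c_1·q(θ) for all θ, where 0 < c_0 ≤ c_1. Let B be the multilevel Toeplitz matrix (with sizes n_1,…,n_m) generated by p, and let T = Σ_{i=1}^m I_{n_1}⊗⋯⊗(l_i·τ(G_{n_i}^{(α_i)}))⊗⋯⊗I_{n_m}. If λ, μ ∈ ℝ and z, y are nonzero real vectors of size N = n_1⋯n_m with B·z = λ·T·z and B·y = μ·T·y, then μ ≥ c_0/4 > 0 and λ/μ ≤ 6·c_1·c_2/c_0;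 that is, the spectral condition number of T^{−1}B is bounded by 6c_1c_2/c_0, a constant independent of the matrix size. -/
open Real Matrix

/-- Grünwald–Letnikov coefficients: `g 0 = 1`, `g k = (1 - (α+1)/k) * g (k-1)` for `k ≥ 1`. -/
noncomputable def glCoef (α : ℝ) : ℕ → ℝ
  | 0 => 1
  | k + 1 => (1 - (α + 1) / ((k : ℝ) + 1)) * glCoef α k

/-- First-column entries of `G_n^{(α)}`: `t_0 = -2g_1`, `t_1 = -(g_0+g_2)`, `t_k = -g_{k+1}` for `k ≥ 2`. -/
noncomputable def tC (α : ℝ) : ℕ → ℝ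
  | 0 => -2 * glCoef α 1
  | 1 => -(glCoef α 0 + glCoef α 2)
  | k + 2 => -glCoef α (k + 3)

/-- Padded coefficients: `t_k` for `k < n`, `0` for `k ≥ n`. -/
noncomputable def tpad (n : ℕ) (t : ℕ → ℝ) (k : ℕ) : ℝ := if k < n then t k else 0

/-- The `n×n` symmetric Toeplitz matrix with `(i,j)` entry `t_{|i-j|}`. -/
noncomputable def toeplitzM (n : ℕ) (t : ℕ → ℝ) : Matrix (Fin n) (Fin n) ℝ :=
  fun i j => t (Nat.dist i.val j.val)

/-- The Hankel matrix `(H_n)_{ij} = t_{i+j} + t_{2(n+1)-(i+j)}` (1-based indices,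
with the convention `t_k = 0` for `k ≥ n`). Here `i j : Fin n` are 0-based. -/
noncomputable def hankelM (n : ℕ) (t : ℕ → ℝ) : Matrix (Fin n) (Fin n) ℝ :=
  fun i j => tpad n t (i.val + j.val + 2) + tpad n t (2 * n - (i.val + j.val))

/-- The τ-matrix `τ(T_n) = T_n - H_n`. -/
noncomputable def tauM (n : ℕ) (t : ℕ → ℝ) : Matrix (Fin n) (Fin n) ℝ :=
  toeplitzM n t - hankelM n t

/-- The matrix `G_n^{(α)}`. -/
noncomputable def Gmat (α : ℝ) (n : ℕ) : Matrix (Fin n) (Fin n) ℝ := toeplitzM n (tC α)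

/-- The multilevel matrix `Σ_i I_{n_1}⊗⋯⊗M_i⊗⋯⊗I_{n_m}`, indexed by tuples `x y` with
`(x,y)` entry `Σ_i (M_i)_{x_i y_i} · Π_{j ≠ i} [x_j = y_j]`. -/
noncomputable def multilevel {m : ℕ} (n : Fin m → ℕ)
    (M : (i : Fin m) → Matrix (Fin (n i)) (Fin (n i)) ℝ) :
    Matrix ((i : Fin m) → Fin (n i)) ((i : Fin m) → Fin (n i)) ℝ :=
  fun x y => ∑ i, M i (x i) (y i) * ∏ j ∈ Finset.univ.erase i, (if x j = y j then (1 : ℝ) else 0)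

open MeasureTheory

theorem glCoef_succ_eq (α : ℝ) (N : ℕ) :
    glCoef α (N + 1) = -α / ((N : ℝ) + 1) * glCoef (α - 1) N := by
  induction N with
  | zero => simp [glCoef]
  | succ k ih =>
    rw [glCoef, ih, glCoef]
    push_cast
    field_simp
    ring

theorem sum_glCoef (α : ℝ) (N : ℕ) :
    ∑ k ∈ Finset.range (N + 1), glCoef α k = glCoef (α - 1) N := by
  induction N with
  | zero => simp [glCoef]
  | succ k ih =>
    rw [Finset.sum_range_succ, ih, glCoef_succ_eq, glCoef]
    field_simp
    ring

theorem glCoef_sub_one_neg {α : ℝ} (hα : α ∈ Set.Ioo (1 : ℝ) 2) (N : ℕ) :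
    glCoef (α - 1) (N + 1) < 0 := by
  obtain ⟨h1, h2⟩ := hα
  induction N with
  | zero => simp [glCoef]; linarith
  | succ k ih =>
    rw [glCoef]
    refine mul_neg_of_pos_of_neg ?_ ih
    push_cast
    rw [sub_pos, div_lt_one (by positivity)]
    have : (0 : ℝ) ≤ k := k.cast_nonneg
    linarith

theorem glCoef_add_two_pos {α : ℝ} (hα : α ∈ Set.Ioo (1 : ℝ) 2) (N : ℕ) :
    0 < glCoef α (N + 2) := by
  rw [glCoef_succ_eq]
  refine mul_pos_of_neg_of_neg ?_ (glCoef_sub_one_neg hα N)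
  have : 0 < α := by linarith [hα.1]
  exact div_neg_of_neg_of_pos (by linarith) (by positivity)

theorem glCoef_add_three_le {α : ℝ} (hα : α ∈ Set.Ioo (1 : ℝ) 2) (N : ℕ) :
    glCoef α (N + 3) ≤ glCoef α (N + 2) := by
  rw [glCoef]
  refine mul_le_of_le_one_left (glCoef_add_two_pos hα N).le ?_
  have : 0 < α := by linarith [hα.1]
  have : 0 < (α + 1) / (((N + 2 : ℕ) : ℝ) + 1) := by positivity
  linarith

theorem summable_glCoef {α : ℝ} (hα : α ∈ Set.Ioo (1 : ℝ) 2) : Summable (glCoef α) := by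
  rw [← summable_nat_add_iff 2]
  refine summable_of_sum_range_le (c := α - 1) (fun k => (glCoef_add_two_pos hα k).le) fun N => ?_
  have h := sum_glCoef α (N + 1)
  rw [Finset.sum_range_succ', Finset.sum_range_succ'] at h
  have h' := glCoef_sub_one_neg hα N
  have h0 : glCoef α 0 = 1 := rfl
  have h1 : glCoef α (0 + 1) = -α := by simp [glCoef]
  rw [h0, h1] at h
  linarith

theorem tC_succ_nonpos {α : ℝ} (hα : α ∈ Set.Ioo (1 : ℝ) 2) (k : ℕ) : tC α (k + 1) ≤ 0 := by
  cases k with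
  | zero =>
    have := glCoef_add_two_pos hα 0
    simp only [tC, glCoef] at *
    linarith
  | succ k =>
    have := glCoef_add_two_pos hα (k + 1)
    simp only [tC]
    linarith

theorem monotone_tC_succ {α : ℝ} (hα : α ∈ Set.Ioo (1 : ℝ) 2) :
    Monotone fun k => tC α (k + 1) := by
  refine monotone_nat_of_le_succ fun k => ?_
  cases k with
  | zero =>
    have := glCoef_add_three_le hα 0
    have h0 : glCoef α 0 = 1 := rfl
    simp only [tC, zero_add] at *
    linarith
  | succ k =>
    have := glCoef_add_three_le hα (k + 1)
    simp only [tC]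
    linarith

theorem tC_zero_add_two_mul_sum_pos {α : ℝ} (hα : α ∈ Set.Ioo (1 : ℝ) 2) (K : ℕ) :
    0 < tC α 0 + 2 * ∑ k ∈ Finset.range K, tC α (k + 1) := by
  have key : ∀ K, tC α 0 + 2 * ∑ k ∈ Finset.range (K + 1), tC α (k + 1) =
      -2 * ∑ k ∈ Finset.range (K + 3), glCoef α k := by
    intro K
    induction K with
    | zero => simp [tC, Finset.sum_range_succ]; ring
    | succ K ih =>
      rw [Finset.sum_range_succ, mul_add, ← add_assoc, ih, Finset.sum_range_succ _ (K + 3)]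
      simp only [tC]
      ring
  cases K with
  | zero =>
    have := hα.1
    simp [tC, glCoef]
    linarith
  | succ K =>
    rw [key, sum_glCoef]
    linarith [glCoef_sub_one_neg hα (K + 1)]

theorem sum_toeplitzM_row (n : ℕ) (t : ℕ → ℝ) (i : Fin n) :
    ∑ j, toeplitzM n t i j = t 0 + ∑ k ∈ Finset.range i, t (k + 1) +
      ∑ k ∈ Finset.range (n - 1 - i), t (k + 1) := by
  obtain ⟨i, hi⟩ := i
  obtain ⟨c, rfl⟩ := Nat.exists_eq_add_of_lt hi
  simp only [toeplitzM]
  rw [Fin.sum_univ_eq_sum_range (fun j => t (Nat.dist i j)) (i + c + 1), add_assoc i c 1,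
    Finset.sum_range_add, Finset.sum_range_succ']
  have h1 : ∑ k ∈ Finset.range i, t (Nat.dist i k) = ∑ k ∈ Finset.range i, t (k + 1) := by
    rw [← Finset.sum_range_reflect]
    refine Finset.sum_congr rfl fun k hk => ?_
    rw [Finset.mem_range] at hk
    congr 1
    simp only [Nat.dist]
    omega
  have h2 : i + (c + 1) - 1 - i = c := by omega
  rw [h1, h2]
  have h3 : ∀ k, Nat.dist i (i + k) = k := fun k => by simp only [Nat.dist]; omega
  simp only [h3]
  ring

theorem sum_tpad_ge (n : ℕ) {t : ℕ → ℝ} (ht : ∀ k, t (k + 1) ≤ 0)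
    (hmono : Monotone fun k => t (k + 1)) {i : ℕ} (hi : i < n) :
    ∑ k ∈ Finset.range (n - 1), t (k + 1) - ∑ k ∈ Finset.range i, t (k + 1) ≤
      ∑ j ∈ Finset.range n, tpad n t (i + j + 2) := by
  obtain ⟨c, rfl⟩ := Nat.exists_eq_add_of_lt hi
  have h0 : ∑ j ∈ Finset.range (i + 1), tpad (i + c + 1) t (i + (c + j) + 2) = 0 :=
    Finset.sum_eq_zero fun j _ => if_neg (by omega)
  rw [Nat.add_sub_cancel, Finset.sum_range_add, add_sub_cancel_left,
    show Finset.range (i + c + 1) = Finset.range (c + (i + 1)) by congr 1; omega,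
    Finset.sum_range_add, h0, add_zero]
  refine Finset.sum_le_sum fun j _ => ?_
  unfold tpad
  split_ifs
  · exact hmono (Nat.le_succ (i + j))
  · exact ht _

theorem hankelM_nonpos (n : ℕ) {t : ℕ → ℝ} (ht : ∀ k, t (k + 1) ≤ 0) (i j : Fin n) :
    hankelM n t i j ≤ 0 := by
  have h : ∀ k, 1 ≤ k → tpad n t k ≤ 0 := by
    intro k hk
    obtain ⟨k, rfl⟩ := Nat.exists_eq_add_of_le' hk
    unfold tpad
    split_ifs
    exacts [ht k, le_rfl]
  exact add_nonpos (h _ (by omega)) (h _ (by omega))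

theorem sum_hankelM_row_ge (n : ℕ) {t : ℕ → ℝ} (ht : ∀ k, t (k + 1) ≤ 0)
    (hmono : Monotone fun k => t (k + 1)) (i : Fin n) :
    2 * ∑ k ∈ Finset.range (n - 1), t (k + 1) - ∑ k ∈ Finset.range i, t (k + 1) -
      ∑ k ∈ Finset.range (n - 1 - i), t (k + 1) ≤ ∑ j, hankelM n t i j := by
  have h1 := sum_tpad_ge n ht hmono i.2
  have h2 := sum_tpad_ge n ht hmono (show n - 1 - (i : ℕ) < n by omega)
  have h3 : ∑ j ∈ Finset.range n, tpad n t (n - 1 - i + j + 2) =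
      ∑ j ∈ Finset.range n, tpad n t (2 * n - (i + j)) := by
    rw [← Finset.sum_range_reflect]
    refine Finset.sum_congr rfl fun k hk => ?_
    rw [Finset.mem_range] at hk
    congr 1
    omega
  simp only [hankelM]
  rw [Fin.sum_univ_eq_sum_range (fun j => tpad n t (i + j + 2) + tpad n t (2 * n - (i + j))) n,
    Finset.sum_add_distrib, ← h3]
  linarith

theorem tauM_nonpos_of_ne (n : ℕ) {t : ℕ → ℝ} (ht : ∀ k, t (k + 1) ≤ 0)
    (hmono : Monotone fun k => t (k + 1)) {i j : Fin n} (hij : i ≠ j) : tauM n t i j ≤ 0 := by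
  have hij' : (i : ℕ) ≠ j := fun h => hij (Fin.ext h)
  have hm : ∀ {a b : ℕ}, 1 ≤ a → a ≤ b → t a ≤ t b := by
    intro a b ha hab
    have := hmono (Nat.sub_le_sub_right hab 1)
    simp only at this
    rwa [Nat.sub_add_cancel ha, Nat.sub_add_cancel (ha.trans hab)] at this
  have hd : 1 ≤ Nat.dist (i : ℕ) j := by simp only [Nat.dist]; omega
  have h0 : t (Nat.dist (i : ℕ) j) ≤ 0 := by
    have := ht (Nat.dist (i : ℕ) j - 1)
    rwa [Nat.sub_add_cancel hd] at this
  have ha : t (Nat.dist (i : ℕ) j) ≤ t (i + j + 2) := hm hd (by simp only [Nat.dist]; omega)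
  have hb : t (Nat.dist (i : ℕ) j) ≤ t (2 * n - (i + j)) := hm hd (by simp only [Nat.dist]; omega)
  simp only [tauM, Matrix.sub_apply, toeplitzM, hankelM, tpad]
  split_ifs
  · omega
  all_goals linarith

theorem hankelM_comm (n : ℕ) (t : ℕ → ℝ) (i j : Fin n) : hankelM n t i j = hankelM n t j i := by
  simp only [hankelM, add_comm (i : ℕ)]

theorem tauM_comm (n : ℕ) (t : ℕ → ℝ) (i j : Fin n) : tauM n t i j = tauM n t j i := by
  simp only [tauM, Matrix.sub_apply, toeplitzM, Nat.dist_comm (i : ℕ), hankelM_comm n t i]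

/-- Row-wise strict dominance of the diagonal of `τ(T_n)`, with room for twice the Hankel part. -/
theorem sum_tauM_row_pos {α : ℝ} (hα : α ∈ Set.Ioo (1 : ℝ) 2) (n : ℕ) (i : Fin n) :
    0 < ∑ j, tauM n (tC α) i j + 2 * ∑ j, hankelM n (tC α) i j := by
  have h1 := sum_toeplitzM_row n (tC α) i
  have h2 := sum_hankelM_row_ge n (tC_succ_nonpos hα) (monotone_tC_succ hα) i
  have h3 := tC_zero_add_two_mul_sum_pos hα (n - 1)
  simp only [tauM, Matrix.sub_apply, Finset.sum_sub_distrib]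
  linarith

/-- The quadratic form `zᵀ A z`. -/
def quadForm {ι : Type*} [Fintype ι] (A : Matrix ι ι ℝ) (z : ι → ℝ) : ℝ :=
  ∑ x, ∑ y, A x y * z x * z y

theorem quadForm_eq_dotProduct {ι : Type*} [Fintype ι] (A : Matrix ι ι ℝ) (z : ι → ℝ) :
    quadForm A z = z ⬝ᵥ A *ᵥ z := by
  simp only [quadForm, dotProduct, mulVec, Finset.mul_sum]
  exact Finset.sum_congr rfl fun x _ => Finset.sum_congr rfl fun y _ => by ring

theorem quadForm_add {ι : Type*} [Fintype ι] (A B : Matrix ι ι ℝ) (z : ι → ℝ) :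
    quadForm (A + B) z = quadForm A z + quadForm B z := by
  simp only [quadForm_eq_dotProduct, add_mulVec, dotProduct_add]

theorem quadForm_smul {ι : Type*} [Fintype ι] (c : ℝ) (A : Matrix ι ι ℝ) (z : ι → ℝ) :
    quadForm (c • A) z = c * quadForm A z := by
  simp only [quadForm_eq_dotProduct, smul_mulVec, dotProduct_smul, smul_eq_mul]

theorem sum_mul_sq_le_quadForm {ι : Type*} [Fintype ι] [DecidableEq ι] {A : Matrix ι ι ℝ}
    (hA : ∀ i j, A i j = A j i) {r : ι → ℝ}
    (h : ∀ i, r i + ∑ j ∈ Finset.univ.erase i, |A i j| ≤ A i i) (z : ι → ℝ) :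
    ∑ i, r i * z i ^ 2 ≤ quadForm A z := by
  have h1 : ∀ i j, (if i = j then A i i * z i ^ 2 else -(|A i j| * (z i ^ 2 + z j ^ 2) / 2)) ≤
      A i j * z i * z j := by
    intro i j
    split_ifs with hij
    · subst hij; exact le_of_eq (by ring)
    · have h2 : |z i * z j| ≤ (z i ^ 2 + z j ^ 2) / 2 := by
        rw [abs_le]
        constructor <;> nlinarith [sq_nonneg (z i + z j), sq_nonneg (z i - z j)]
      have h3 := mul_le_mul_of_nonneg_left h2 (abs_nonneg (A i j))
      rw [← abs_mul] at h3
      have h4 := neg_abs_le (A i j * (z i * z j))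
      linarith
  refine le_trans ?_ (Finset.sum_le_sum fun i _ => Finset.sum_le_sum fun j _ => h1 i j)
  have h2 : ∀ i, ∑ j, (if i = j then A i i * z i ^ 2 else -(|A i j| * (z i ^ 2 + z j ^ 2) / 2)) =
      A i i * z i ^ 2 - (∑ j ∈ Finset.univ.erase i, |A i j|) * z i ^ 2 / 2 -
        ∑ j ∈ Finset.univ.erase i, |A i j| * z j ^ 2 / 2 := by
    intro i
    rw [← Finset.add_sum_erase _ _ (Finset.mem_univ i), if_pos rfl, Finset.sum_mul,
      Finset.sum_div, sub_sub, ← Finset.sum_add_distrib, sub_eq_add_neg, ← Finset.sum_neg_distrib]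
    congr 1
    refine Finset.sum_congr rfl fun j hj => ?_
    rw [if_neg (Finset.ne_of_mem_erase hj).symm]
    ring
  have h3 : ∑ i, ∑ j ∈ Finset.univ.erase i, |A i j| * z j ^ 2 / 2 =
      ∑ i, (∑ j ∈ Finset.univ.erase i, |A i j|) * z i ^ 2 / 2 := by
    rw [Finset.sum_comm' (t' := Finset.univ) (s' := fun j => Finset.univ.erase j)
      (by simp [eq_comm])]
    refine Finset.sum_congr rfl fun i _ => ?_
    rw [Finset.sum_mul, Finset.sum_div]
    exact Finset.sum_congr rfl fun j _ => by rw [hA j i]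
  simp only [h2, Finset.sum_sub_distrib]
  rw [h3, ← Finset.sum_sub_distrib, ← Finset.sum_sub_distrib]
  refine Finset.sum_le_sum fun i _ => ?_
  have := mul_le_mul_of_nonneg_right (h i) (sq_nonneg (z i))
  linarith

theorem quadForm_tauM_add_smul_hankelM_pos {α : ℝ} (hα : α ∈ Set.Ioo (1 : ℝ) 2) (n : ℕ) {s : ℝ}
    (hs : |s| ≤ 2) {z : Fin n → ℝ} (hz : z ≠ 0) :
    0 < quadForm (tauM n (tC α) + s • hankelM n (tC α)) z := by
  obtain ⟨i₀, hi₀⟩ := Function.ne_iff.mp hz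
  have hh := hankelM_nonpos n (tC_succ_nonpos hα)
  have hs' := abs_le.mp hs
  refine lt_of_lt_of_le ?_ (sum_mul_sq_le_quadForm
    (r := fun i => ∑ j, tauM n (tC α) i j + 2 * ∑ j, hankelM n (tC α) i j) ?_ ?_ z)
  · refine Finset.sum_pos' (fun i _ => mul_nonneg (sum_tauM_row_pos hα n i).le (sq_nonneg _))
      ⟨i₀, Finset.mem_univ _, mul_pos (sum_tauM_row_pos hα n i₀) ?_⟩
    exact sq_pos_of_ne_zero hi₀
  · intro i j
    simp only [Matrix.add_apply, Matrix.smul_apply, tauM_comm n _ i j, hankelM_comm n _ i j]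
  · intro i
    have h1 : ∑ j ∈ Finset.univ.erase i, |(tauM n (tC α) + s • hankelM n (tC α)) i j| ≤
        ∑ j ∈ Finset.univ.erase i, (-tauM n (tC α) i j - 2 * hankelM n (tC α) i j) := by
      refine Finset.sum_le_sum fun j hj => ?_
      have hτ := tauM_nonpos_of_ne n (tC_succ_nonpos hα) (monotone_tC_succ hα)
        (Finset.ne_of_mem_erase hj).symm
      have := hh i j
      rw [Matrix.add_apply, Matrix.smul_apply, smul_eq_mul, abs_le]
      constructor <;> nlinarith
    rw [Finset.sum_sub_distrib, Finset.sum_neg_distrib, ← Finset.mul_sum] at h1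
    simp only [← Finset.add_sum_erase _ _ (Finset.mem_univ i), Matrix.add_apply,
      Matrix.smul_apply, smul_eq_mul] at h1 ⊢
    have := hh i i
    nlinarith

theorem quadForm_sum {ι κ : Type*} [Fintype ι] (s : Finset κ) (A : κ → Matrix ι ι ℝ) (z : ι → ℝ) :
    quadForm (∑ k ∈ s, A k) z = ∑ k ∈ s, quadForm (A k) z := by
  simp only [quadForm_eq_dotProduct, sum_mulVec, dotProduct_sum]

/-- A multilevel quadratic form is a sum of one-level forms over the lines of the index grid. -/
theorem quadForm_multilevel {m : ℕ} (n : Fin m → ℕ)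
    (M : (i : Fin m) → Matrix (Fin (n i)) (Fin (n i)) ℝ) (z : ((i : Fin m) → Fin (n i)) → ℝ) :
    quadForm (multilevel n M) z = ∑ i, ∑ r, quadForm (M i)
      (fun a => z ((Equiv.piSplitAt i fun j => Fin (n j)).symm (a, r))) := by
  have h : multilevel n M = ∑ i, Matrix.of fun x y =>
      M i (x i) (y i) * ∏ j ∈ Finset.univ.erase i, (if x j = y j then (1 : ℝ) else 0) := by
    ext x y
    simp only [multilevel, Matrix.sum_apply, Matrix.of_apply]
  rw [h, quadForm_sum]
  refine Finset.sum_congr rfl fun i _ => ?_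
  let e := Equiv.piSplitAt i fun j => Fin (n j)
  have hprod : ∀ p q, (∏ j ∈ Finset.univ.erase i,
      if e.symm p j = e.symm q j then (1 : ℝ) else 0) = if p.2 = q.2 then 1 else 0 := by
    intro p q
    have hne : ∀ p (j : {j // j ≠ i}), e.symm p j = p.2 j := fun p j => by
      simp [e, Equiv.piSplitAt, j.2]
    split_ifs with hpq
    · refine Finset.prod_eq_one fun j hj => if_pos ?_
      rw [hne p ⟨j, Finset.ne_of_mem_erase hj⟩, hne q ⟨j, Finset.ne_of_mem_erase hj⟩, hpq]
    · obtain ⟨j, hj⟩ := Function.ne_iff.mp hpq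
      refine Finset.prod_eq_zero (Finset.mem_erase.2 ⟨j.2, Finset.mem_univ _⟩) (if_neg ?_)
      rwa [hne, hne]
  have hi : ∀ p, e.symm p i = p.1 := fun p => by simp [e, Equiv.piSplitAt]
  simp only [quadForm, Matrix.of_apply]
  rw [← e.symm.sum_comp, Fintype.sum_prod_type, Finset.sum_comm]
  refine Finset.sum_congr rfl fun r _ => Finset.sum_congr rfl fun a _ => ?_
  rw [← e.symm.sum_comp, Fintype.sum_prod_type]
  refine Finset.sum_congr rfl fun b _ => ?_
  simp only [hprod, hi]
  rw [Finset.sum_eq_single r]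
  · simp [e]
  · intro s _ hs
    simp [hs.symm]
  · simp

theorem quadForm_zero {ι : Type*} [Fintype ι] (A : Matrix ι ι ℝ) :
    quadForm A 0 = 0 := by
  simp [quadForm]

theorem quadForm_multilevel_pos {m : ℕ} (hm : 1 ≤ m) (n : Fin m → ℕ)
    {M : (i : Fin m) → Matrix (Fin (n i)) (Fin (n i)) ℝ}
    (hM : ∀ i (v : Fin (n i) → ℝ), v ≠ 0 → 0 < quadForm (M i) v)
    {z : ((i : Fin m) → Fin (n i)) → ℝ} (hz : z ≠ 0) :
    0 < quadForm (multilevel n M) z := by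
  have hM' : ∀ i (v : Fin (n i) → ℝ), 0 ≤ quadForm (M i) v := by
    intro i v
    rcases eq_or_ne v 0 with rfl | hv
    · rw [quadForm_zero]
    · exact (hM i v hv).le
  obtain ⟨x, hx⟩ := Function.ne_iff.mp hz
  rw [quadForm_multilevel]
  let i : Fin m := ⟨0, hm⟩
  refine Finset.sum_pos' (fun i _ => Finset.sum_nonneg fun r _ => hM' i _)
    ⟨i, Finset.mem_univ _, Finset.sum_pos' (fun r _ => hM' i _)
      ⟨(Equiv.piSplitAt i (fun j => Fin (n j)) x).2, Finset.mem_univ _, hM i _ ?_⟩⟩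
  refine Function.ne_iff.mpr ⟨(Equiv.piSplitAt i (fun j => Fin (n j)) x).1, ?_⟩
  change z ((Equiv.piSplitAt i fun j => Fin (n j)).symm (Equiv.piSplitAt i _ x)) ≠ 0
  rwa [Equiv.symm_apply_apply]

theorem multilevel_smul_add_smul {m : ℕ} (n : Fin m → ℕ) (l : Fin m → ℝ) (s : ℝ)
    (M N : (i : Fin m) → Matrix (Fin (n i)) (Fin (n i)) ℝ) :
    multilevel n (fun i => l i • (M i + s • N i)) =
      multilevel n (fun i => l i • M i) + s • multilevel n (fun i => l i • N i) := by
  ext x y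
  simp only [multilevel, Matrix.add_apply, Matrix.smul_apply, smul_eq_mul, Finset.mul_sum,
    ← Finset.sum_add_distrib]
  exact Finset.sum_congr rfl fun i _ => by ring

theorem quadForm_multilevel_tauM_bounds {m : ℕ} (hm : 1 ≤ m) (n : Fin m → ℕ) {α l : Fin m → ℝ}
    (hα : ∀ i, α i ∈ Set.Ioo (1 : ℝ) 2) (hl : ∀ i, 0 < l i)
    {z : ((i : Fin m) → Fin (n i)) → ℝ} (hz : z ≠ 0) :
    0 < quadForm (multilevel n fun i => l i • tauM (n i) (tC (α i))) z ∧
    quadForm (multilevel n fun i => l i • tauM (n i) (tC (α i))) z ≤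
      2 * quadForm (multilevel n fun i => l i • Gmat (α i) (n i)) z ∧
    2 * quadForm (multilevel n fun i => l i • Gmat (α i) (n i)) z ≤
      3 * quadForm (multilevel n fun i => l i • tauM (n i) (tC (α i))) z := by
  have key : ∀ s : ℝ, |s| ≤ 2 →
      0 < quadForm (multilevel n fun i => l i • tauM (n i) (tC (α i))) z +
        s * quadForm (multilevel n fun i => l i • hankelM (n i) (tC (α i))) z := by
    intro s hs
    rw [← quadForm_smul, ← quadForm_add, ← multilevel_smul_add_smul]
    refine quadForm_multilevel_pos hm n (fun i v hv => ?_) hz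
    rw [quadForm_smul]
    exact mul_pos (hl i) (quadForm_tauM_add_smul_hankelM_pos (hα i) (n i) hs hv)
  have hG : quadForm (multilevel n fun i => l i • Gmat (α i) (n i)) z =
      quadForm (multilevel n fun i => l i • tauM (n i) (tC (α i))) z +
        1 * quadForm (multilevel n fun i => l i • hankelM (n i) (tC (α i))) z := by
    rw [← quadForm_smul, ← quadForm_add, ← multilevel_smul_add_smul]
    simp only [tauM, one_smul, sub_add_cancel, Gmat]
  have h0 := key 0 (by norm_num)
  have h1 := key 2 (by norm_num)
  have h2 := key (-2) (by norm_num)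
  refine ⟨by linarith, by linarith, by linarith⟩

theorem glCoef_eq_choose (α : ℝ) (k : ℕ) :
    (glCoef α k : ℂ) = (-1) ^ k * Ring.choose (α : ℂ) k := by
  induction k with
  | zero => simp [glCoef]
  | succ k ih =>
    rw [glCoef]
    push_cast
    rw [ih, Ring.choose_eq_smul, Ring.choose_eq_smul, descPochhammer_succ_right,
      Polynomial.smeval_mul, Polynomial.smeval_sub, Polynomial.smeval_X,
      Polynomial.smeval_natCast, Nat.factorial_succ]
    have h1 : ((k : ℂ) + 1) ≠ 0 := by exact_mod_cast Nat.succ_ne_zero k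
    have h2 : ((k.factorial : ℕ) : ℂ) ≠ 0 := by exact_mod_cast k.factorial_ne_zero
    simp only [smul_eq_mul, pow_one, pow_zero, nsmul_eq_mul, mul_one]
    push_cast
    field_simp
    ring

theorem hasSum_glCoef_mul_pow (α : ℝ) {w : ℂ} (hw : ‖w‖ < 1) :
    HasSum (fun k => (glCoef α k : ℂ) * w ^ k) ((1 - w) ^ (α : ℂ)) := by
  have h := (Complex.one_add_cpow_hasFPowerSeriesOnBall_zero (a := (α : ℂ))).hasSum (y := -w)
    (by rw [← ENNReal.ofReal_one, Metric.eball_ofReal]; simpa using hw)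
  rw [zero_add, ← sub_eq_add_neg] at h
  refine h.congr_fun fun k => ?_
  rw [glCoef_eq_choose, binomialSeries_apply]
  simp [List.ofFn_const, neg_pow w]
  ring

/-- The Grünwald–Letnikov generating function on the unit circle, by Abel's theorem. -/
theorem tsum_glCoef_mul_pow {α : ℝ} (hα : α ∈ Set.Ioo (1 : ℝ) 2) {w : ℂ} (hw : ‖w‖ = 1)
    (hw' : 1 - w ∈ Complex.slitPlane) :
    HasSum (fun k => (glCoef α k : ℂ) * w ^ k) ((1 - w) ^ (α : ℂ)) := by
  have hs : Summable fun k => (glCoef α k : ℂ) * w ^ k := by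
    refine Summable.of_norm ?_
    simpa [hw] using (summable_glCoef hα).abs
  have h1 := Complex.tendsto_tsum_powerSeries_nhdsWithin_lt hs.hasSum.tendsto_sum_nat
  rw [Filter.tendsto_map'_iff] at h1
  have h2 : Filter.Tendsto (fun r : ℝ => (1 - w * r) ^ (α : ℂ)) (nhdsWithin 1 (Set.Iio 1))
      (nhds ((1 - w) ^ (α : ℂ))) := by
    have hc : ContinuousAt (fun r : ℝ => (1 - w * r) ^ (α : ℂ)) 1 :=
      ContinuousAt.cpow (by fun_prop) continuousAt_const (by simpa using hw')
    simpa using hc.tendsto.mono_left nhdsWithin_le_nhds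
  have h3 : ∀ᶠ r : ℝ in nhdsWithin 1 (Set.Iio 1), (1 - w * r) ^ (α : ℂ) =
      ∑' k, (glCoef α k : ℂ) * w ^ k * (r : ℂ) ^ k := by
    filter_upwards [Ioo_mem_nhdsLT (show (0 : ℝ) < 1 by norm_num)] with r hr
    have := (hasSum_glCoef_mul_pow α (w := w * r)
      (by simpa [hw, abs_of_pos hr.1] using hr.2)).tsum_eq
    rw [← this]
    exact tsum_congr fun k => by rw [mul_pow, mul_assoc]
  rw [tendsto_nhds_unique (h2.congr' h3) h1]
  exact hs.hasSum

/-- The generating function of the Toeplitz matrices `G_n^{(α)}`. -/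
noncomputable def rieszSymbol (α θ : ℝ) : ℝ :=
  tC α 0 + 2 * ∑' k : ℕ, tC α (k + 1) * cos (((k : ℝ) + 1) * θ)

theorem summable_tC_succ {α : ℝ} (hα : α ∈ Set.Ioo (1 : ℝ) 2) :
    Summable fun k => tC α (k + 1) := by
  rw [← summable_nat_add_iff 1]
  exact ((summable_nat_add_iff 3).mpr (summable_glCoef hα)).neg

theorem summable_tC_succ_mul_cos {α : ℝ} (hα : α ∈ Set.Ioo (1 : ℝ) 2) (θ : ℝ) :
    Summable fun k : ℕ => tC α (k + 1) * cos (((k : ℝ) + 1) * θ) := by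
  refine Summable.of_norm_bounded (summable_tC_succ hα).norm fun k => ?_
  rw [norm_mul]
  exact mul_le_of_le_one_right (norm_nonneg _) (abs_cos_le_one _)

theorem continuous_rieszSymbol {α : ℝ} (hα : α ∈ Set.Ioo (1 : ℝ) 2) :
    Continuous (rieszSymbol α) := by
  refine continuous_const.add (continuous_const.mul
    (continuous_tsum (fun k => by fun_prop) (summable_tC_succ hα).norm fun k θ => ?_))
  rw [norm_mul]
  exact mul_le_of_le_one_right (norm_nonneg _) (abs_cos_le_one _)

theorem rieszSymbol_abs (α θ : ℝ) : rieszSymbol α |θ| = rieszSymbol α θ := by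
  rcases abs_choice θ with h | h <;> simp [h, rieszSymbol]

theorem rieszSymbol_eq_tsum_glCoef {α : ℝ} (hα : α ∈ Set.Ioo (1 : ℝ) 2) (θ : ℝ) :
    rieszSymbol α θ = -2 * ∑' k : ℕ, glCoef α k * cos (((k : ℝ) - 1) * θ) := by
  have hs : Summable fun k : ℕ => glCoef α k * cos (((k : ℝ) - 1) * θ) := by
    refine Summable.of_norm_bounded (summable_glCoef hα).norm fun k => ?_
    rw [norm_mul]
    exact mul_le_of_le_one_right (norm_nonneg _) (abs_cos_le_one _)
  rw [rieszSymbol, ← hs.sum_add_tsum_nat_add 3,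
    ← (summable_tC_succ_mul_cos hα θ).sum_add_tsum_nat_add 1]
  have h : ∀ k : ℕ, tC α (k + 1 + 1) * cos ((((k + 1 : ℕ) : ℝ) + 1) * θ) =
      -(glCoef α (k + 3) * cos ((((k + 3 : ℕ) : ℝ) - 1) * θ)) := by
    intro k
    rw [tC, neg_mul]
    congr 4
    push_cast
    ring
  rw [tsum_congr h, tsum_neg]
  simp only [Finset.sum_range_succ, Finset.sum_range_zero, tC]
  norm_num
  ring

theorem rieszSymbol_eq {α : ℝ} (hα : α ∈ Set.Ioo (1 : ℝ) 2) {θ : ℝ} (hθ : θ ∈ Set.Ioc 0 π) :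
    rieszSymbol α θ = 2 * (2 * sin (θ / 2)) ^ α * -cos (π * α / 2 + θ * (1 - α / 2)) := by
  obtain ⟨h0, hπ⟩ := hθ
  have hsin : 0 < 2 * sin (θ / 2) :=
    mul_pos two_pos (sin_pos_of_pos_of_lt_pi (by linarith) (by linarith))
  set L := log (2 * sin (θ / 2)) with hL
  let v : ℂ := ⟨L, (θ - π) / 2⟩
  have hv : 1 - Complex.exp (θ * Complex.I) = Complex.exp v := by
    have hc : (θ - π) / 2 = θ / 2 - π / 2 := by ring
    have h2 : θ = 2 * (θ / 2) := by ring
    apply Complex.ext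
    · rw [Complex.exp_re, Complex.sub_re, Complex.exp_ofReal_mul_I_re, Complex.one_re]
      simp only [v]
      rw [hL, exp_log hsin, hc, cos_sub_pi_div_two]
      nth_rw 1 [h2]
      rw [cos_two_mul, cos_sq']
      ring
    · rw [Complex.exp_im, Complex.sub_im, Complex.exp_ofReal_mul_I_im, Complex.one_im]
      simp only [v]
      rw [hL, exp_log hsin, hc, sin_sub_pi_div_two]
      nth_rw 1 [h2]
      rw [sin_two_mul]
      ring
  have hcos : cos θ < 1 := by
    have := cos_lt_cos_of_nonneg_of_le_pi le_rfl hπ h0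
    rwa [cos_zero] at this
  have hslit : 1 - Complex.exp (θ * Complex.I) ∈ Complex.slitPlane := by
    left
    rw [Complex.sub_re, Complex.exp_ofReal_mul_I_re, Complex.one_re]
    linarith
  have hsum := ((tsum_glCoef_mul_pow hα (Complex.norm_exp_ofReal_mul_I θ) hslit).mul_left
    (Complex.exp (-θ * Complex.I)))
  have hre := (Complex.hasSum_re hsum).tsum_eq
  have hterm : ∀ k : ℕ, (Complex.exp (-θ * Complex.I) * ((glCoef α k : ℂ) *
      Complex.exp (θ * Complex.I) ^ k)).re = glCoef α k * cos (((k : ℝ) - 1) * θ) := by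
    intro k
    rw [← Complex.exp_nat_mul, mul_left_comm, ← Complex.exp_add, Complex.re_ofReal_mul,
      ← Complex.exp_ofReal_mul_I_re]
    congr 3
    push_cast
    ring
  simp only [hterm] at hre
  rw [rieszSymbol_eq_tsum_glCoef hα, hre, hv, Complex.cpow_def_of_ne_zero (Complex.exp_ne_zero _),
    Complex.log_exp (by simp only [v]; linarith) (by simp only [v]; linarith), ← Complex.exp_add,
    Complex.exp_re, rpow_def_of_pos hsin, ← hL]
  rw [show π * α / 2 + θ * (1 - α / 2) = -(-θ + (θ - π) / 2 * α) by ring, cos_neg]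
  simp [v]
  ring

theorem rieszSymbol_bounds {α : ℝ} (hα : α ∈ Set.Ioo (1 : ℝ) 2) {θ : ℝ}
    (hθ : θ ∈ Set.Icc (-π) π) :
    rieszSymbol α θ ≤ 2 * |θ| ^ α ∧
      |θ| ^ α ≤ π ^ 2 / (-8 * cos (π * α / 2)) * rieszSymbol α θ := by
  obtain ⟨hα1, hα2⟩ := hα
  have hC : 0 < -cos (π * α / 2) := by
    rw [neg_pos]
    apply cos_neg_of_pi_div_two_lt_of_lt <;> nlinarith [pi_pos]
  have hα : α ∈ Set.Ioo (1 : ℝ) 2 := ⟨hα1, hα2⟩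
  have hpos : ∀ t ∈ Set.Ioc 0 π, rieszSymbol α t ≤ 2 * |t| ^ α ∧
      |t| ^ α ≤ π ^ 2 / (-8 * cos (π * α / 2)) * rieszSymbol α t := by
    rintro t ⟨h0, hπ⟩
    have hsin : 0 < 2 * sin (t / 2) :=
      mul_pos two_pos (sin_pos_of_pos_of_lt_pi (by linarith) (by linarith))
    have hR : 0 < (2 * sin (t / 2)) ^ α := rpow_pos_of_pos hsin α
    have hle : (2 * sin (t / 2)) ^ α ≤ t ^ α := by
      have := sin_lt (show 0 < t / 2 by linarith)
      exact rpow_le_rpow hsin.le (by linarith) (by linarith)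
    have hge : t ^ α ≤ π ^ 2 / 4 * (2 * sin (t / 2)) ^ α := by
      have h1 := mul_le_sin (show 0 ≤ t / 2 by linarith) (by linarith)
      have h2 : t ≤ π / 2 * (2 * sin (t / 2)) := by
        have := mul_le_mul_of_nonneg_left h1 pi_pos.le
        have h3 : π * (2 / π * (t / 2)) = t := by field_simp
        linarith
      have h3 := rpow_le_rpow h0.le h2 (by linarith : 0 ≤ α)
      rw [mul_rpow (by positivity) hsin.le] at h3
      have h4 : (π / 2) ^ α ≤ (π / 2) ^ (2 : ℝ) :=
        rpow_le_rpow_of_exponent_le (by linarith [pi_gt_three]) hα2.le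
      rw [rpow_two, div_pow] at h4
      norm_num at h4
      exact h3.trans (mul_le_mul_of_nonneg_right h4 hR.le)
    have hu : -cos (π * α / 2) ≤ -cos (π * α / 2 + t * (1 - α / 2)) := by
      refine neg_le_neg (cos_le_cos_of_nonneg_of_le_pi ?_ ?_ ?_) <;> nlinarith [pi_pos]
    have hu1 : -cos (π * α / 2 + t * (1 - α / 2)) ≤ 1 := by
      linarith [neg_one_le_cos (π * α / 2 + t * (1 - α / 2))]
    rw [rieszSymbol_eq hα ⟨h0, hπ⟩, abs_of_pos h0]
    refine ⟨by nlinarith, hge.trans ?_⟩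
    have h5 : π ^ 2 / 4 * (2 * sin (t / 2)) ^ α = π ^ 2 / (-8 * cos (π * α / 2)) *
        (2 * (2 * sin (t / 2)) ^ α * -cos (π * α / 2)) := by
      have : cos (π * α / 2) ≠ 0 := by linarith
      field_simp
      norm_num
    rw [h5]
    have : 0 ≤ π ^ 2 / (-8 * cos (π * α / 2)) := div_nonneg (sq_nonneg _) (by linarith)
    gcongr
  rw [← rieszSymbol_abs]
  have habs : |θ| ≤ π := abs_le.mpr hθ
  rcases (abs_nonneg θ).eq_or_lt with h | h
  · rw [← h]
    have hmem : ∀ᶠ t in nhdsWithin (0 : ℝ) (Set.Ioi 0), t ∈ Set.Ioc 0 π :=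
      Ioc_mem_nhdsGT pi_pos
    have hc := (continuous_rieszSymbol hα).tendsto 0
    have hr : Filter.Tendsto (fun t : ℝ => |t| ^ α) (nhds 0) (nhds (0 ^ α)) := by
      have : Continuous fun t : ℝ => |t| ^ α :=
        continuous_abs.rpow_const fun _ => Or.inr (by linarith)
      simpa using this.tendsto 0
    exact ⟨le_of_tendsto_of_tendsto (hc.mono_left nhdsWithin_le_nhds)
        ((hr.const_mul 2).mono_left nhdsWithin_le_nhds) (hmem.mono fun t ht => (hpos t ht).1),
      le_of_tendsto_of_tendsto (hr.mono_left nhdsWithin_le_nhds)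
        ((hc.const_mul _).mono_left nhdsWithin_le_nhds) (hmem.mono fun t ht => (hpos t ht).2)⟩
  · simpa using hpos |θ| ⟨h, habs⟩

theorem integral_exp_int_mul (d : ℤ) :
    ∫ θ in Set.Icc (-π) π, Complex.exp (((θ * d : ℝ) : ℂ) * Complex.I) =
      if d = 0 then 2 * (π : ℂ) else 0 := by
  split_ifs with h
  · have : π + π = 2 * π := by ring
    simp [h, pi_pos.le, this]
  · have hc : (d : ℂ) * Complex.I ≠ 0 := mul_ne_zero (Int.cast_ne_zero.mpr h) Complex.I_ne_zero
    rw [integral_Icc_eq_integral_Ioc,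
      ← intervalIntegral.integral_of_le (by linarith [pi_pos])]
    have h1 : ∀ θ : ℝ, ((θ * d : ℝ) : ℂ) * Complex.I = (d : ℂ) * Complex.I * θ := fun θ => by
      push_cast; ring
    simp only [h1]
    rw [integral_exp_mul_complex hc, Complex.exp_eq_exp_iff_exists_int.mpr ⟨d, ?_⟩, sub_self,
      zero_div]
    push_cast
    ring

theorem integral_cos_mul_exp (d : ℤ) (k : ℕ) :
    ∫ θ in Set.Icc (-π) π, (cos (((k : ℝ) + 1) * θ) : ℂ) *
      Complex.exp (((θ * d : ℝ) : ℂ) * Complex.I) =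
      if k + 1 = d.natAbs then (π : ℂ) else 0 := by
  have h : ∀ θ : ℝ, (cos (((k : ℝ) + 1) * θ) : ℂ) * Complex.exp (((θ * d : ℝ) : ℂ) * Complex.I) =
      Complex.exp (((θ * (d + (k + 1) : ℤ) : ℝ) : ℂ) * Complex.I) / 2 +
      Complex.exp (((θ * (d - (k + 1) : ℤ) : ℝ) : ℂ) * Complex.I) / 2 := by
    intro θ
    rw [Complex.ofReal_cos, Complex.cos, div_mul_eq_mul_div, add_mul, ← Complex.exp_add,
      ← Complex.exp_add, ← add_div]
    congr 3 <;> push_cast <;> ring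
  have hfint : ∀ e : ℤ, IntegrableOn (fun θ : ℝ =>
      Complex.exp (((θ * e : ℝ) : ℂ) * Complex.I) / 2) (Set.Icc (-π) π) := fun e =>
    Continuous.integrableOn_Icc (by fun_prop)
  simp only [h]
  rw [integral_add (hfint _) (hfint _), integral_div, integral_div, integral_exp_int_mul,
    integral_exp_int_mul]
  split_ifs <;> first | omega | ring

theorem integral_rieszSymbol_mul_exp {α : ℝ} (hα : α ∈ Set.Ioo (1 : ℝ) 2) (d : ℤ) :
    ∫ θ in Set.Icc (-π) π, (rieszSymbol α θ : ℂ) * Complex.exp (((θ * d : ℝ) : ℂ) * Complex.I) =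
      2 * π * tC α d.natAbs := by
  let F : ℕ → ℝ → ℂ := fun k θ => (tC α (k + 1) : ℂ) * ((cos (((k : ℝ) + 1) * θ) : ℂ) *
      Complex.exp (((θ * d : ℝ) : ℂ) * Complex.I))
  have hFc : ∀ k, Continuous (F k) := fun k => by fun_prop
  have hFn : ∀ k θ, ‖F k θ‖ ≤ |tC α (k + 1)| := by
    intro k θ
    simp only [F]
    rw [norm_mul, norm_mul, Complex.norm_exp_ofReal_mul_I, mul_one, Complex.norm_real,
      Complex.norm_real]
    exact mul_le_of_le_one_right (norm_nonneg _) (abs_cos_le_one _)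
  have hFi : ∀ k, IntegrableOn (F k) (Set.Icc (-π) π) := fun k => (hFc k).integrableOn_Icc
  have hsum : Summable fun k => ∫ θ in Set.Icc (-π) π, ‖F k θ‖ := by
    refine Summable.of_nonneg_of_le (fun k => integral_nonneg fun θ => norm_nonneg _)
      (fun k => ?_) ((summable_tC_succ hα).abs.mul_left (2 * π))
    refine (setIntegral_mono (hFi k).norm (integrableOn_const (by simp)) (hFn k)).trans ?_
    rw [setIntegral_const, smul_eq_mul]
    simp [pi_pos.le, two_mul]
  have h := (hasSum_integral_of_summable_integral_norm hFi hsum).tsum_eq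
  have hsymb : ∀ θ : ℝ, (rieszSymbol α θ : ℂ) * Complex.exp (((θ * d : ℝ) : ℂ) * Complex.I) =
      tC α 0 * Complex.exp (((θ * d : ℝ) : ℂ) * Complex.I) + 2 * ∑' k, F k θ := by
    intro θ
    simp only [rieszSymbol, F, ← mul_assoc]
    rw [tsum_mul_right]
    push_cast
    ring
  have hF : ∀ k, ∫ θ in Set.Icc (-π) π, F k θ =
      if k + 1 = d.natAbs then (tC α (k + 1) : ℂ) * π else 0 := by
    intro k
    simp only [F]
    rw [integral_const_mul, integral_cos_mul_exp, mul_ite, mul_zero]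
  have hFsum : Continuous fun θ => ∑' k, F k θ :=
    continuous_tsum hFc (summable_tC_succ hα).abs hFn
  simp only [hsymb]
  rw [integral_add (Continuous.integrableOn_Icc (by fun_prop))
    (Continuous.integrableOn_Icc (by fun_prop)), integral_const_mul, integral_const_mul,
    integral_exp_int_mul, ← h]
  simp only [hF]
  rcases Nat.eq_zero_or_eq_succ_pred d.natAbs with h0 | h0
  · simp only [h0, Nat.succ_ne_zero, if_false, tsum_zero, if_pos (Int.natAbs_eq_zero.mp h0)]
    ring
  · set e := d.natAbs.pred
    rw [tsum_eq_single e (fun k hk => if_neg (by omega)), if_pos h0.symm, if_neg (by omega), h0,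
      Nat.succ_eq_add_one]
    ring

theorem volume_restrict_pi_Icc (m : ℕ) :
    (volume : Measure (Fin m → ℝ)).restrict (Set.univ.pi fun _ : Fin m => Set.Icc (-π) π) =
      Measure.pi fun _ => volume.restrict (Set.Icc (-π) π) := by
  rw [volume_pi, Measure.restrict_pi_pi]

theorem integrableOn_pi_Icc_of_continuous {m : ℕ} {f : (Fin m → ℝ) → ℝ} (hf : Continuous f) :
    IntegrableOn f (Set.univ.pi fun _ : Fin m => Set.Icc (-π) π) :=
  hf.continuousOn.integrableOn_compact (isCompact_univ_pi fun _ => isCompact_Icc)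

/-- The multilevel Toeplitz matrix of a function of one coordinate acts on one level only. -/
theorem mToeplitz_rieszSymbol {m : ℕ} (n : Fin m → ℕ) {α : ℝ} (hα : α ∈ Set.Ioo (1 : ℝ) 2)
    (i : Fin m) (x y : (i : Fin m) → Fin (n i)) :
    mToeplitz n (fun θ => rieszSymbol α (θ i)) x y =
      Gmat α (n i) (x i) (y i) * ∏ j ∈ Finset.univ.erase i, (if x j = y j then (1 : ℝ) else 0) := by
  let d : Fin m → ℤ := fun j => ((x j : ℕ) : ℤ) - ((y j : ℕ) : ℤ)
  let f : Fin m → ℝ → ℂ := fun j t => (if j = i then (rieszSymbol α t : ℂ) else 1) *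
    Complex.exp (((t * d j : ℝ) : ℂ) * Complex.I)
  have hfi : ∀ j ∈ Finset.univ.erase i, ∫ t in Set.Icc (-π) π, f j t =
      2 * π * (if x j = y j then (1 : ℂ) else 0) := by
    intro j hj
    simp only [f, if_neg (Finset.ne_of_mem_erase hj), one_mul, integral_exp_int_mul, mul_ite,
      mul_one, mul_zero]
    refine if_congr ?_ rfl rfl
    simp only [d, Fin.ext_iff]
    omega
  have hii : ∫ t in Set.Icc (-π) π, f i t = 2 * π * Gmat α (n i) (x i) (y i) := by
    simp only [f, if_true, integral_rieszSymbol_mul_exp hα, Gmat, toeplitzM]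
    congr 3
    simp only [d, Nat.dist]
    omega
  have hprod : ∀ θ : Fin m → ℝ, ∏ j, f j (θ j) = (rieszSymbol α (θ i) : ℂ) *
      Complex.exp (((∑ j, θ j * (((x j : ℕ) : ℝ) - ((y j : ℕ) : ℝ)) : ℝ) : ℂ) * Complex.I) := by
    intro θ
    simp only [f]
    rw [Finset.prod_mul_distrib, Finset.prod_ite_eq' Finset.univ i, if_pos (Finset.mem_univ _),
      ← Complex.exp_sum, ← Finset.sum_mul]
    simp [d]
  have hre : ∀ θ : Fin m → ℝ, rieszSymbol α (θ i) *
      cos (∑ j, θ j * (((x j : ℕ) : ℝ) - ((y j : ℕ) : ℝ))) = (∏ j, f j (θ j)).re := by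
    intro θ
    rw [hprod, Complex.re_ofReal_mul, Complex.exp_ofReal_mul_I_re]
  have hfint : IntegrableOn (fun θ : Fin m → ℝ => ∏ j, f j (θ j))
      (Set.univ.pi fun _ : Fin m => Set.Icc (-π) π) := by
    simp only [hprod]
    have := continuous_rieszSymbol hα
    exact (Continuous.continuousOn (by fun_prop)).integrableOn_compact
      (isCompact_univ_pi fun _ => isCompact_Icc)
  simp only [mToeplitz, hre]
  have hI := integral_re hfint
  simp only [RCLike.re_eq_complex_re] at hI
  rw [hI, volume_restrict_pi_Icc, integral_fintype_prod_eq_prod,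
    ← Finset.mul_prod_erase _ _ (Finset.mem_univ i), hii, Finset.prod_congr rfl hfi,
    Finset.prod_mul_distrib, Finset.prod_const, Finset.card_erase_of_mem (Finset.mem_univ i),
    Finset.card_univ, Fintype.card_fin]
  have hm : m = (m - 1) + 1 := by have := i.2; omega
  have hcast : 2 * (π : ℂ) * Gmat α (n i) (x i) (y i) * ((2 * π) ^ (m - 1) *
      ∏ j ∈ Finset.univ.erase i, (if x j = y j then (1 : ℂ) else 0)) =
      (((2 * π) ^ m * (Gmat α (n i) (x i) (y i) *
        ∏ j ∈ Finset.univ.erase i, (if x j = y j then (1 : ℝ) else 0)) : ℝ) : ℂ) := by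
    have : ((2 * (π : ℂ)) ^ m) = (2 * π) ^ (m - 1) * (2 * π) := by rw [← pow_succ, ← hm]
    push_cast
    rw [this]
    simp only [apply_ite Complex.ofReal, Complex.ofReal_one, Complex.ofReal_zero]
    ring
  rw [hcast, Complex.ofReal_re, _root_.zpow_neg, zpow_natCast, inv_mul_cancel_left₀ (by positivity)]

theorem mToeplitz_sum_rieszSymbol {m : ℕ} (n : Fin m → ℕ) {α l : Fin m → ℝ}
    (hα : ∀ i, α i ∈ Set.Ioo (1 : ℝ) 2) :
    mToeplitz n (fun θ => ∑ i, l i * rieszSymbol (α i) (θ i)) =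
      multilevel n fun i => l i • Gmat (α i) (n i) := by
  ext x y
  simp only [multilevel, Matrix.smul_apply, smul_eq_mul, mul_assoc, ← mToeplitz_rieszSymbol n (hα _)]
  simp only [mToeplitz, Finset.sum_mul]
  rw [integral_finsetSum, Finset.mul_sum]
  · refine Finset.sum_congr rfl fun i _ => ?_
    simp only [mul_assoc]
    rw [integral_const_mul]
    ring
  · intro i _
    have := continuous_rieszSymbol (hα i)
    exact integrableOn_pi_Icc_of_continuous (by fun_prop)

theorem mToeplitz_const_mul {m : ℕ} (n : Fin m → ℕ) (c : ℝ) (f : (Fin m → ℝ) → ℝ) :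
    mToeplitz n (fun θ => c * f θ) = c • mToeplitz n f := by
  ext x y
  simp only [mToeplitz, Matrix.smul_apply, smul_eq_mul, mul_assoc, integral_const_mul]
  ring

theorem quadForm_mToeplitz {m : ℕ} (n : Fin m → ℕ) {f : (Fin m → ℝ) → ℝ}
    (hf : IntegrableOn f (Set.univ.pi fun _ : Fin m => Set.Icc (-π) π))
    (z : ((i : Fin m) → Fin (n i)) → ℝ) :
    quadForm (mToeplitz n f) z = (2 * π) ^ (-(m : ℤ)) *
      ∫ θ in Set.univ.pi fun _ : Fin m => Set.Icc (-π) π,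
        f θ * ((∑ x, z x * cos (∑ i, θ i * ((x i : ℕ) : ℝ))) ^ 2 +
          (∑ x, z x * sin (∑ i, θ i * ((x i : ℕ) : ℝ))) ^ 2) := by
  have hfint : ∀ x y : (i : Fin m) → Fin (n i), IntegrableOn (fun θ => f θ *
      cos (∑ i, θ i * (((x i : ℕ) : ℝ) - ((y i : ℕ) : ℝ))) * z x * z y)
      (Set.univ.pi fun _ : Fin m => Set.Icc (-π) π) := fun x y =>
    ((hf.mul_continuousOn (Continuous.continuousOn (by fun_prop))
      (isCompact_univ_pi fun _ => isCompact_Icc)).mul_const _).mul_const _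
  have hsq : ∀ θ : Fin m → ℝ, f θ * ((∑ x : (i : Fin m) → Fin (n i),
      z x * cos (∑ i, θ i * ((x i : ℕ) : ℝ))) ^ 2 +
      (∑ x, z x * sin (∑ i, θ i * ((x i : ℕ) : ℝ))) ^ 2) = ∑ x, ∑ y, f θ *
      cos (∑ i, θ i * (((x i : ℕ) : ℝ) - ((y i : ℕ) : ℝ))) * z x * z y := by
    intro θ
    rw [sq, sq, Finset.sum_mul_sum, Finset.sum_mul_sum]
    simp only [← Finset.sum_add_distrib, Finset.mul_sum]
    simp only [mul_sub, Finset.sum_sub_distrib, cos_sub]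
    exact Finset.sum_congr rfl fun x _ => Finset.sum_congr rfl fun y _ => by ring
  simp only [hsq]
  rw [integral_finsetSum _ fun x _ => integrable_finsetSum _ fun y _ => hfint x y, quadForm,
    Finset.mul_sum]
  refine Finset.sum_congr rfl fun x _ => ?_
  rw [integral_finsetSum _ fun y _ => hfint x y, Finset.mul_sum]
  refine Finset.sum_congr rfl fun y _ => ?_
  rw [integral_mul_const, integral_mul_const, mToeplitz]
  ring

theorem quadForm_mToeplitz_mono {m : ℕ} (n : Fin m → ℕ) {f g : (Fin m → ℝ) → ℝ}
    (hf : IntegrableOn f (Set.univ.pi fun _ : Fin m => Set.Icc (-π) π))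
    (hg : IntegrableOn g (Set.univ.pi fun _ : Fin m => Set.Icc (-π) π))
    (hfg : ∀ θ : Fin m → ℝ, (∀ i, θ i ∈ Set.Icc (-π) π) → f θ ≤ g θ)
    (z : ((i : Fin m) → Fin (n i)) → ℝ) :
    quadForm (mToeplitz n f) z ≤ quadForm (mToeplitz n g) z := by
  have hK : IsCompact (Set.univ.pi fun _ : Fin m => Set.Icc (-π) π) :=
    isCompact_univ_pi fun _ => isCompact_Icc
  rw [quadForm_mToeplitz n hf, quadForm_mToeplitz n hg]
  refine mul_le_mul_of_nonneg_left (setIntegral_mono_on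
    (hf.mul_continuousOn (Continuous.continuousOn (by fun_prop)) hK)
    (hg.mul_continuousOn (Continuous.continuousOn (by fun_prop)) hK) hK.measurableSet
    fun θ hθ => ?_) (by positivity)
  exact mul_le_mul_of_nonneg_right (hfg θ fun i => hθ i (Set.mem_univ i)) (by positivity)

theorem cond_number_B_tau (m : ℕ) (hm : 1 ≤ m) (n : Fin m → ℕ) (hn : ∀ i, 1 ≤ n i)
    (α l : Fin m → ℝ) (hα : ∀ i, α i ∈ Set.Ioo (1 : ℝ) 2) (hl : ∀ i, 0 < l i)
    (p : (Fin m → ℝ) → ℝ)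
    (hp : IntegrableOn p (Set.univ.pi fun _ : Fin m => Set.Icc (-π) π))
    (c0 c1 : ℝ) (hc0 : 0 < c0) (hc01 : c0 ≤ c1)
    (hpq : ∀ θ : Fin m → ℝ, (∀ i, θ i ∈ Set.Icc (-π) π) →
      c0 * (∑ i, l i * |θ i| ^ (α i)) ≤ p θ ∧ p θ ≤ c1 * (∑ i, l i * |θ i| ^ (α i)))
    (c2 : ℝ)
    (hc2 : c2 = Finset.univ.sup' ⟨(⟨0, hm⟩ : Fin m), Finset.mem_univ _⟩
      (fun i => π ^ 2 / (-8 * Real.cos (π * α i / 2))))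
    (lam mu : ℝ) (z y : ((i : Fin m) → Fin (n i)) → ℝ) (hz : z ≠ 0) (hy : y ≠ 0)
    (h1 : (mToeplitz n p).mulVec z =
          lam • (multilevel n (fun i => l i • tauM (n i) (tC (α i)))).mulVec z)
    (h2 : (mToeplitz n p).mulVec y =
          mu • (multilevel n (fun i => l i • tauM (n i) (tC (α i)))).mulVec y) :
    c0 / 4 ≤ mu ∧ 0 < mu ∧ lam / mu ≤ 6 * c1 * c2 / c0 := by
  have hG : Continuous fun θ : Fin m → ℝ => ∑ i, l i * rieszSymbol (α i) (θ i) :=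
    continuous_finsetSum _ fun i _ =>
      continuous_const.mul ((continuous_rieszSymbol (hα i)).comp (continuous_apply i))
  have hc1 : 0 < c1 := hc0.trans_le hc01
  have hcos : ∀ i, 0 < π ^ 2 / (-8 * Real.cos (π * α i / 2)) := by
    intro i
    obtain ⟨h1, h2⟩ := hα i
    have : Real.cos (π * α i / 2) < 0 := by
      apply cos_neg_of_pi_div_two_lt_of_lt <;> nlinarith [pi_pos]
    exact div_pos (by positivity) (by linarith)
  have hc2i : ∀ i, π ^ 2 / (-8 * Real.cos (π * α i / 2)) ≤ c2 := fun i => by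
    rw [hc2]
    exact Finset.le_sup' (fun i => π ^ 2 / (-8 * Real.cos (π * α i / 2))) (Finset.mem_univ i)
  have hc2pos : 0 < c2 := (hcos ⟨0, hm⟩).trans_le (hc2i _)
  have hlower : ∀ w, c0 / 2 * quadForm (multilevel n fun i => l i • Gmat (α i) (n i)) w ≤
      quadForm (mToeplitz n p) w := by
    intro w
    rw [← mToeplitz_sum_rieszSymbol n hα, ← quadForm_smul, ← mToeplitz_const_mul]
    refine quadForm_mToeplitz_mono n (integrableOn_pi_Icc_of_continuous (continuous_const.mul hG))
      hp (fun θ hθ => le_trans ?_ (hpq θ hθ).1) w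
    change c0 / 2 * ∑ i, l i * rieszSymbol (α i) (θ i) ≤ _
    rw [div_mul_eq_mul_div, mul_div_assoc, Finset.sum_div]
    refine mul_le_mul_of_nonneg_left (Finset.sum_le_sum fun i _ => ?_) hc0.le
    rw [mul_div_assoc]
    refine mul_le_mul_of_nonneg_left ?_ (hl i).le
    linarith [(rieszSymbol_bounds (hα i) (hθ i)).1]
  have hupper : ∀ w, quadForm (mToeplitz n p) w ≤
      c1 * c2 * quadForm (multilevel n fun i => l i • Gmat (α i) (n i)) w := by
    intro w
    rw [← mToeplitz_sum_rieszSymbol n hα, ← quadForm_smul, ← mToeplitz_const_mul]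
    refine quadForm_mToeplitz_mono n hp (integrableOn_pi_Icc_of_continuous (continuous_const.mul hG))
      (fun θ hθ => (hpq θ hθ).2.trans ?_) w
    change _ ≤ c1 * c2 * ∑ i, l i * rieszSymbol (α i) (θ i)
    rw [mul_assoc, Finset.mul_sum _ _ c2]
    refine mul_le_mul_of_nonneg_left (Finset.sum_le_sum fun i _ => ?_) hc1.le
    have h := (rieszSymbol_bounds (hα i) (hθ i)).2
    have hnn : 0 ≤ rieszSymbol (α i) (θ i) :=
      nonneg_of_mul_nonneg_right ((rpow_nonneg (abs_nonneg _) _).trans h) (hcos i)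
    rw [mul_left_comm]
    exact mul_le_mul_of_nonneg_left (h.trans (mul_le_mul_of_nonneg_right (hc2i i) hnn)) (hl i).le
  obtain ⟨hzpos, -, hzle⟩ := quadForm_multilevel_tauM_bounds hm n hα hl hz
  obtain ⟨hypos, hyge, -⟩ := quadForm_multilevel_tauM_bounds hm n hα hl hy
  have hquad : ∀ {w : ((i : Fin m) → Fin (n i)) → ℝ} {c : ℝ},
      (mToeplitz n p).mulVec w =
        c • (multilevel n (fun i => l i • tauM (n i) (tC (α i)))).mulVec w →
      quadForm (mToeplitz n p) w =
        c * quadForm (multilevel n fun i => l i • tauM (n i) (tC (α i))) w := by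
    intro w c h
    rw [quadForm_eq_dotProduct, quadForm_eq_dotProduct, h, dotProduct_smul, smul_eq_mul]
  have hmu : c0 / 4 ≤ mu := by
    have h := hlower y
    rw [hquad h2] at h
    refine le_of_mul_le_mul_right (le_trans ?_ h) hypos
    nlinarith
  have hlam : lam ≤ 3 / 2 * (c1 * c2) := by
    have h := hupper z
    rw [hquad h1] at h
    refine le_of_mul_le_mul_right (h.trans ?_) hzpos
    nlinarith [mul_pos hc1 hc2pos]
  have hmupos : 0 < mu := lt_of_lt_of_le (by positivity) hmu
  refine ⟨hmu, hmupos, ?_⟩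
  rw [div_le_div_iff₀ hmupos hc0]
  nlinarith [mul_pos hc1 hc2pos]
end
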